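/- For Newtonian space-time data, and for each u ∈ V₁, the map Θ_u : E × V* → P defined by Θ_u(x,γ) = [(u,x,γ)] is a bijection. Moreover, for u, u' ∈ V₁ and every (x,γ) ∈ E × V*, one has Θ_{u'}(x,γ) = Θ_u(x, γ + m·σ(u',u)); that is, Θ_u⁻¹ ∘ Θ_{u'} is the translation (x,γ) ↦ (x, γ + m·σ(u',u)) by the constant 1-form m·σ(u',u). -/

import Mathlib

/-- The functional `σ(u,u') ∈ V*` of Newtonian space-time data. -/
noncomputable def nsigma {V : Type*} [AddCommGroup V] [Module ℝ V]
    (τ : V →ₗ[ℝ] ℝ)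
    (g : LinearMap.ker τ →ₗ[ℝ] LinearMap.ker τ →ₗ[ℝ] ℝ)
    (u u' : {v : V // τ v = 1}) (v : V) : ℝ :=
  g ⟨u.1 - u'.1, by
      simp only [LinearMap.mem_ker, map_sub, u.2, u'.2]; ring⟩
    ⟨v - (τ v / 2) • (u.1 + u'.1), by
      simp only [LinearMap.mem_ker, map_sub, map_smul, map_add, u.2, u'.2, smul_eq_mul]; ring⟩

/-- The relation `∼` on `V₁ × E × V*`. -/
noncomputable def nrel {V : Type*} [AddCommGroup V] [Module ℝ V] (E : Type*)
    (τ : V →ₗ[ℝ] ℝ)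
    (g : LinearMap.ker τ →ₗ[ℝ] LinearMap.ker τ →ₗ[ℝ] ℝ) (m : ℝ) :
    ({v : V // τ v = 1} × E × (V →ₗ[ℝ] ℝ)) →
      ({v : V // τ v = 1} × E × (V →ₗ[ℝ] ℝ)) → Prop :=
  fun p q => p.2.1 = q.2.1 ∧ ∀ v : V, q.2.2 v = p.2.2 v + m * nsigma τ g p.1 q.1 v

section

variable {V : Type*} [AddCommGroup V] [Module ℝ V] {τ : V →ₗ[ℝ] ℝ}
  (g : LinearMap.ker τ →ₗ[ℝ] LinearMap.ker τ →ₗ[ℝ] ℝ)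

theorem nsigma_self (u : {v : V // τ v = 1}) (v : V) : nsigma τ g u u v = 0 := by
  have h : (⟨u.1 - u.1, by simp⟩ : LinearMap.ker τ) = 0 := Subtype.ext (sub_self u.1)
  simp only [nsigma, h, map_zero, LinearMap.zero_apply]

/-- The cocycle identity for `σ`. -/
theorem nsigma_add_nsigma (hsymm : ∀ x y : LinearMap.ker τ, g x y = g y x)
    (u₁ u₂ u₃ : {v : V // τ v = 1}) (v : V) :
    nsigma τ g u₁ u₂ v + nsigma τ g u₂ u₃ v = nsigma τ g u₁ u₃ v := by
  let a : LinearMap.ker τ := ⟨u₁.1 - u₂.1, by simp [u₁.2, u₂.2]⟩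
  let b : LinearMap.ker τ := ⟨u₂.1 - u₃.1, by simp [u₂.2, u₃.2]⟩
  let w : LinearMap.ker τ := ⟨v - τ v • u₂.1, by simp [u₂.2]⟩
  have h₁₂ : nsigma τ g u₁ u₂ v = g a (w - (τ v / 2) • a) := by
    refine congrArg (g a) (Subtype.ext ?_)
    change v - (τ v / 2) • (u₁.1 + u₂.1) = v - τ v • u₂.1 - (τ v / 2) • (u₁.1 - u₂.1)
    module
  have h₂₃ : nsigma τ g u₂ u₃ v = g b (w + (τ v / 2) • b) := by
    refine congrArg (g b) (Subtype.ext ?_)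
    change v - (τ v / 2) • (u₂.1 + u₃.1) = v - τ v • u₂.1 + (τ v / 2) • (u₂.1 - u₃.1)
    module
  have h₁₃ : nsigma τ g u₁ u₃ v = g (a + b) (w - (τ v / 2) • (a - b)) := by
    refine congrArg₂ (fun x y => g x y) (Subtype.ext ?_) (Subtype.ext ?_)
    · exact (sub_add_sub_cancel u₁.1 u₂.1 u₃.1).symm
    · change v - (τ v / 2) • (u₁.1 + u₃.1) =
        v - τ v • u₂.1 - (τ v / 2) • (u₁.1 - u₂.1 - (u₂.1 - u₃.1))
      module
  rw [h₁₂, h₂₃, h₁₃]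
  simp only [map_add, map_sub, map_smul, LinearMap.add_apply, smul_eq_mul, hsymm b a]
  ring

theorem isLinearMap_nsigma (u u' : {v : V // τ v = 1}) : IsLinearMap ℝ (nsigma τ g u u') where
  map_add v w := by
    refine (congrArg (g _) (Subtype.ext ?_)).trans (map_add (g _) _ _)
    change v + w - (τ (v + w) / 2) • (u.1 + u'.1) =
      v - (τ v / 2) • (u.1 + u'.1) + (w - (τ w / 2) • (u.1 + u'.1))
    rw [map_add]
    module
  map_smul c v := by
    refine (congrArg (g _) (Subtype.ext ?_)).trans (map_smul (g _) c _)
    change c • v - (τ (c • v) / 2) • (u.1 + u'.1) = c • (v - (τ v / 2) • (u.1 + u'.1))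
    rw [map_smul, smul_eq_mul]
    module

theorem nrel_equivalence (E : Type*) (hsymm : ∀ x y : LinearMap.ker τ, g x y = g y x) (m : ℝ) :
    Equivalence (nrel E τ g m) where
  refl p := ⟨rfl, fun v => by rw [nsigma_self, mul_zero, add_zero]⟩
  symm {p q} h := ⟨h.1.symm, fun v => by
    have hσ := nsigma_add_nsigma g hsymm p.1 q.1 p.1 v
    rw [nsigma_self] at hσ
    linear_combination -h.2 v - m * hσ⟩
  trans {p q r} h h' := ⟨h.1.trans h'.1, fun v => by
    linear_combination h.2 v + h'.2 v + m * nsigma_add_nsigma g hsymm p.1 q.1 r.1 v⟩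

end

/-- For Newtonian space-time data and each `u ∈ V₁`, the map
`Θ_u : E × V* → P`, `(x,γ) ↦ [(u,x,γ)]`, is a bijection; and for `u, u' ∈ V₁`,
`Θ_{u'}(x,γ) = Θ_u(x, γ + m·σ(u',u))`, i.e. `Θ_u⁻¹ ∘ Θ_{u'}` is the translation
by the constant 1-form `m·σ(u',u)`. -/
theorem stmt_16 {V : Type*} [AddCommGroup V] [Module ℝ V] (E : Type*) [Nonempty E]
    (τ : V →ₗ[ℝ] ℝ) (hτ : τ ≠ 0)
    (g : LinearMap.ker τ →ₗ[ℝ] LinearMap.ker τ →ₗ[ℝ] ℝ)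
    (hsymm : ∀ x y : LinearMap.ker τ, g x y = g y x) (m : ℝ)
    (u u' : {v : V // τ v = 1}) :
    Function.Bijective
      (fun p : E × (V →ₗ[ℝ] ℝ) => Quot.mk (nrel E τ g m) (u, p.1, p.2)) ∧
    ∀ (x : E) (γ γ' : V →ₗ[ℝ] ℝ),
      (∀ v : V, γ' v = γ v + m * nsigma τ g u' u v) →
      Quot.mk (nrel E τ g m) (u', x, γ) = Quot.mk (nrel E τ g m) (u, x, γ') := by
  refine ⟨⟨?_, ?_⟩, fun x γ γ' h => Quot.sound ⟨rfl, h⟩⟩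
  · rintro ⟨x, γ⟩ ⟨x', γ'⟩ h
    obtain ⟨hx, hγ⟩ := (nrel_equivalence g E hsymm m).eqvGen_iff.1 (Quot.eqvGen_exact h)
    refine Prod.ext hx (LinearMap.ext fun v => ?_)
    have hv := hγ v
    rw [nsigma_self, mul_zero, add_zero] at hv
    exact hv.symm
  · rintro ⟨u₀, x, α⟩
    exact ⟨(x, α + m • (isLinearMap_nsigma g u₀ u).mk'),
      (Quot.sound ⟨rfl, fun v => rfl⟩ : Quot.mk _ (u₀, x, α) = _).symm⟩
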